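/- arXiv:1711.06937 — 7 statements merged into one kernel-verified Lean document; each statement's English description precedes it below -/
import Mathlib

section
/- Let n ≥ 4 be an even integer, let h > 0 be a real number, and let t₁, …, tₙ be reals with 0 < t₁ ≤ t₂ ≤ ⋯ ≤ tₙ and t_{n/2} ≤ h·t₁. Then SC_M(t) ≤ (2h + 1)·t₁, where SC_M(t) = ∫₀^{t₁} ∏_{i=2}^{n} (1 − y/tᵢ) dy + Σ_{k=2}^{n} (1/t₁)·∫₀^{t₁} ∫₀^{y} ∏_{i ∈ {2,…,n}, i ≠ k} (1 − x/tᵢ) dx dy. -/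
open MeasureTheory Finset

/-- The expected social cost of Koutsoupias's truthful scheduling mechanism on a
nondecreasingly sorted input `s` (index `⟨0, hn⟩` plays the role of machine 1). -/
noncomputable def SCM {n : ℕ} (s : Fin n → ℝ) (hn : 0 < n) : ℝ :=
  (∫ y in (0:ℝ)..(s ⟨0, hn⟩),
      ∏ i ∈ Finset.univ.filter (fun i => i ≠ (⟨0, hn⟩ : Fin n)), (1 - y / s i)) +
  ∑ k ∈ Finset.univ.filter (fun k => k ≠ (⟨0, hn⟩ : Fin n)),
    (1 / s ⟨0, hn⟩) *
      ∫ y in (0:ℝ)..(s ⟨0, hn⟩), ∫ x in (0:ℝ)..y,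
        ∏ i ∈ Finset.univ.filter (fun i => i ≠ (⟨0, hn⟩ : Fin n) ∧ i ≠ k), (1 - x / s i)

/-- Bounding each factor of a product of linear factors indexed by a subset by `1 - x / H`. -/
lemma prod_one_sub_div_le_pow {ι : Type*} {S T : Finset ι} (hTS : T ⊆ S) {t : ι → ℝ}
    {a H x : ℝ} (ha : 0 < a) (hat : ∀ i, a ≤ t i) (hT : ∀ i ∈ T, t i ≤ H)
    (hx0 : 0 ≤ x) (hxa : x ≤ a) :
    ∏ i ∈ S, (1 - x / t i) ≤ (1 - x / H) ^ #T := by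
  have hnonneg : ∀ i, 0 ≤ 1 - x / t i := fun i =>
    sub_nonneg.2 (div_le_one_of_le₀ (hxa.trans (hat i)) (ha.le.trans (hat i)))
  have hle : ∀ i, 1 - x / t i ≤ 1 := fun i =>
    sub_le_self _ (div_nonneg hx0 (ha.le.trans (hat i)))
  calc ∏ i ∈ S, (1 - x / t i) ≤ ∏ i ∈ T, (1 - x / t i) :=
        prod_le_prod_of_subset_of_le_one hTS (fun i _ => hnonneg i) fun i _ _ => hle i
    _ ≤ (1 - x / H) ^ #T := by
        refine (prod_le_prod (fun i _ => hnonneg i) fun i hi => ?_).trans_eq (prod_const _)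
        have hti := ha.trans_le (hat i)
        have hle_H := hT i hi
        gcongr

/-- An upper bound on the integral of a power of a linear factor. -/
lemma integral_one_sub_div_pow_le {H y : ℝ} (hH : 0 < H) (hyH : y ≤ H) (p : ℕ) :
    ∫ x in (0 : ℝ)..y, (1 - x / H) ^ p ≤ H / (p + 1) := by
  have hint : ∫ x in (0 : ℝ)..y, (1 - x / H) ^ p =
      H * ((1 - (1 - y / H) ^ (p + 1)) / (p + 1)) := by
    rw [intervalIntegral.integral_comp_sub_div (fun u : ℝ => u ^ p) hH.ne' 1, integral_pow]
    simp
  have hnonneg : 0 ≤ (1 - y / H) ^ (p + 1) :=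
    pow_nonneg (sub_nonneg.2 (div_le_one_of_le₀ hyH hH.le)) _
  rw [hint, mul_div_assoc']
  gcongr
  nlinarith

/-- The average over `[0, a]` of the inner integrals of the social cost is at most
`H / (#T + 1)` whenever the product contains the factors of a set `T` on which `t ≤ H`. -/
lemma average_integral_prod_le {ι : Type*} {S T : Finset ι} (hTS : T ⊆ S) {t : ι → ℝ}
    {a H : ℝ} (ha : 0 < a) (haH : a ≤ H) (hat : ∀ i, a ≤ t i) (hT : ∀ i ∈ T, t i ≤ H) :
    (1 / a) * ∫ y in (0 : ℝ)..a, ∫ x in (0 : ℝ)..y, ∏ i ∈ S, (1 - x / t i) ≤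
      H / (#T + 1) := by
  have hcont : Continuous fun x : ℝ => ∏ i ∈ S, (1 - x / t i) := by fun_prop
  have hcont' : Continuous fun y : ℝ => ∫ x in (0 : ℝ)..y, ∏ i ∈ S, (1 - x / t i) :=
    intervalIntegral.continuous_primitive (fun _ _ => hcont.intervalIntegrable _ _) 0
  have hpow : Continuous fun x : ℝ => (1 - x / H) ^ #T := by fun_prop
  have hle : ∫ y in (0 : ℝ)..a, ∫ x in (0 : ℝ)..y, ∏ i ∈ S, (1 - x / t i) ≤
      ∫ _y in (0 : ℝ)..a, H / (#T + 1) := by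
    refine intervalIntegral.integral_mono_on ha.le (hcont'.intervalIntegrable _ _)
      (continuous_const.intervalIntegrable _ _) fun y hy => ?_
    refine le_trans ?_ (integral_one_sub_div_pow_le (ha.trans_le haH) (hy.2.trans haH) #T)
    exact intervalIntegral.integral_mono_on hy.1 (hcont.intervalIntegrable _ _)
      (hpow.intervalIntegrable _ _) fun x hx =>
        prod_one_sub_div_le_pow hTS ha hat hT hx.1 (hx.2.trans hy.2)
  rw [intervalIntegral.integral_const, smul_eq_mul, sub_zero] at hle
  rwa [one_div, inv_mul_le_iff₀ ha]

/-- The integral over `[0, a]` of a product of factors at most `1` is at most `a`. -/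
lemma integral_prod_one_sub_div_le {ι : Type*} (S : Finset ι) {t : ι → ℝ} {a : ℝ}
    (ha : 0 < a) (hat : ∀ i, a ≤ t i) :
    ∫ y in (0 : ℝ)..a, ∏ i ∈ S, (1 - y / t i) ≤ a := by
  have hcont : Continuous fun x : ℝ => ∏ i ∈ S, (1 - x / t i) := by fun_prop
  have hle : ∫ y in (0 : ℝ)..a, ∏ i ∈ S, (1 - y / t i) ≤ ∫ _y in (0 : ℝ)..a, (1 : ℝ) :=
    intervalIntegral.integral_mono_on ha.le (hcont.intervalIntegrable _ _)
      (continuous_const.intervalIntegrable _ _) fun y hy => by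
        simpa using prod_one_sub_div_le_pow (H := a) (empty_subset S) ha hat (by simp) hy.1 hy.2
  simpa using hle

theorem social_cost_bound_under_event_A
    (n : ℕ) (hn4 : 4 ≤ n) (hne : Even n) (h : ℝ) (hh : 0 < h)
    (t : Fin n → ℝ) (hpos : 0 < t ⟨0, by omega⟩) (hmono : Monotone t)
    (hA : t ⟨n / 2 - 1, by omega⟩ ≤ h * t ⟨0, by omega⟩) :
    SCM t (by omega) ≤ (2 * h + 1) * t ⟨0, by omega⟩ := by
  obtain ⟨r, hr⟩ := hne
  set z : Fin n := ⟨0, by omega⟩ with hz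
  set w : Fin n := ⟨r, by omega⟩ with hw
  set H : ℝ := h * t z with hH
  have hat : ∀ i, t z ≤ t i := fun i => hmono (Fin.mk_le_of_le_val (Nat.zero_le _))
  have hsmall : ∀ i ∈ Ioo z w, t i ≤ H := fun i hi => by
    refine (hmono ?_).trans hA
    have hlt : i.val < r := (mem_Ioo.1 hi).2
    rw [Fin.le_def]
    simp only
    omega
  have haH : t z ≤ H := (hat _).trans hA
  have hcard : #(Ioo z w) = r - 1 := by simp [Fin.card_Ioo, hz, hw]
  have hcard' : #(Ici w) = r := by simp [Fin.card_Ici, hw]; omega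
  have hr1 : ((r - 1 : ℕ) : ℝ) ≠ 0 := Nat.cast_ne_zero.2 (by omega)
  have hr0 : (r : ℝ) ≠ 0 := Nat.cast_ne_zero.2 (by omega)
  have hdisj : Disjoint (Ioo z w) (Ici w) := disjoint_left.2 fun i hi hi' =>
    (mem_Ioo.1 hi).2.not_ge (mem_Ici.1 hi')
  have hunion : univ.filter (fun k => k ≠ z) = Ioo z w ∪ Ici w := by
    ext k
    simp only [mem_filter, mem_univ, true_and, mem_union, mem_Ioo, mem_Ici, Fin.lt_def,
      Fin.le_def, ne_eq, Fin.ext_iff, hz, hw]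
    omega
  have hsub : ∀ k, (Ioo z w).erase k ⊆ univ.filter (fun i => i ≠ z ∧ i ≠ k) := fun k i hi => by
    rw [mem_erase, mem_Ioo] at hi
    simpa using ⟨hi.2.1.ne', hi.1⟩
  have hbound := fun k => average_integral_prod_le (hsub k) hpos haH hat
    fun i hi => hsmall i (mem_of_mem_erase hi)
  have hfirst := integral_prod_one_sub_div_le (univ.filter (fun k => k ≠ z)) hpos hat
  unfold SCM
  rw [← hz]
  have hsumA := sum_le_card_nsmul (Ioo z w) _ (H / (r - 1 : ℕ)) fun k hk =>
    (hbound k).trans_eq (by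
      rw [card_erase_of_mem hk, hcard, ← Nat.cast_add_one]
      congr 2
      omega)
  have hsumB := sum_le_card_nsmul (Ici w) _ (H / r) fun k hk =>
    (hbound k).trans_eq (by
      rw [erase_eq_of_notMem (disjoint_right.1 hdisj hk), hcard, ← Nat.cast_add_one]
      congr 2
      omega)
  rw [hcard, nsmul_eq_mul, mul_div_cancel₀ _ hr1] at hsumA
  rw [hcard', nsmul_eq_mul, mul_div_cancel₀ _ hr0] at hsumB
  have hsum := add_le_add hsumA hsumB
  rw [← sum_union hdisj, ← hunion] at hsum
  linarith
end

section
/- Let n ≥ 4 be an even integer, let h > 0 be a real number, and let t₁, …, tₙ be reals with 0 < t₁ ≤ t₂ ≤ ⋯ ≤ tₙ and t_{n/2} ≤ h·t₁. Then for every index k with 2 ≤ k ≤ n and every real x with 0 ≤ x ≤ t₁, one has ∏_{i ∈ {2,…,n}, i ≠ k} (1 − x/tᵢ) ≤ (1 − x/(h·t₁))^{n/2 − 2}. -/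
open Finset

/-- If all factors of a product lie in `[0, 1]` and at least `N` of them are at most `c ≤ 1`,
then the product is at most `c ^ N`. -/
theorem prod_le_pow_of_le_card {ι : Type*} {s A : Finset ι} {f : ι → ℝ} {c : ℝ} {N : ℕ}
    (hAs : A ⊆ s) (hf0 : ∀ i ∈ s, 0 ≤ f i) (hf1 : ∀ i ∈ s, f i ≤ 1)
    (hfc : ∀ i ∈ A, f i ≤ c) (hc0 : 0 ≤ c) (hc1 : c ≤ 1) (hN : N ≤ #A) :
    ∏ i ∈ s, f i ≤ c ^ N := by
  classical
  have hA : ∏ i ∈ A, f i ≤ c ^ #A := by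
    simpa using Finset.prod_le_prod (fun i hi => hf0 i (hAs hi)) hfc
  have hrest : ∏ i ∈ s \ A, f i ≤ 1 :=
    Finset.prod_le_one (fun i hi => hf0 i (Finset.sdiff_subset hi))
      (fun i hi => hf1 i (Finset.sdiff_subset hi))
  calc ∏ i ∈ s, f i = (∏ i ∈ s \ A, f i) * ∏ i ∈ A, f i := (Finset.prod_sdiff hAs).symm
    _ ≤ ∏ i ∈ A, f i :=
      mul_le_of_le_one_left (Finset.prod_nonneg fun i hi => hf0 i (hAs hi)) hrest
    _ ≤ c ^ #A := hA
    _ ≤ c ^ N := pow_le_pow_of_le_one hc0 hc1 hN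

theorem product_pointwise_bound
    (n : ℕ) (hn4 : 4 ≤ n) (hne : Even n) (h : ℝ) (hh : 0 < h)
    (t : Fin n → ℝ) (hpos : 0 < t ⟨0, by omega⟩) (hmono : Monotone t)
    (hA : t ⟨n / 2 - 1, by omega⟩ ≤ h * t ⟨0, by omega⟩)
    (k : Fin n) (hk : k ≠ ⟨0, by omega⟩)
    (x : ℝ) (hx0 : 0 ≤ x) (hx1 : x ≤ t ⟨0, by omega⟩) :
    ∏ i ∈ Finset.univ.filter (fun i => i ≠ (⟨0, by omega⟩ : Fin n) ∧ i ≠ k), (1 - x / t i)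
      ≤ (1 - x / (h * t ⟨0, by omega⟩)) ^ (n / 2 - 2) := by
  set a : Fin n := ⟨0, by omega⟩
  set m : Fin n := ⟨n / 2 - 1, by omega⟩
  have ha : ∀ i, t a ≤ t i := fun i => hmono (Fin.mk_le_of_le_val (Nat.zero_le _))
  have hti : ∀ i, 0 < t i := fun i => hpos.trans_le (ha i)
  have hht : t a ≤ h * t a := (ha m).trans hA
  have hcard : n / 2 - 2 ≤ #((Finset.Ioc a m).erase k) := by
    have h1 := Finset.pred_card_le_card_erase (s := Finset.Ioc a m) (a := k)
    have h2 : #(Finset.Ioc a m) = n / 2 - 1 := by simp [a, m]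
    omega
  refine prod_le_pow_of_le_card (A := (Finset.Ioc a m).erase k) ?_ ?_ ?_ ?_ ?_ ?_ hcard
  · intro i hi
    simp only [Finset.mem_erase, Finset.mem_Ioc] at hi
    simpa using ⟨hi.2.1.ne', hi.1⟩
  · intro i _
    exact sub_nonneg.2 ((div_le_one (hti i)).2 (hx1.trans (ha i)))
  · intro i _
    exact sub_le_self _ (div_nonneg hx0 (hti i).le)
  · intro i hi
    simp only [Finset.mem_erase, Finset.mem_Ioc] at hi
    exact sub_le_sub_left
      (div_le_div_of_nonneg_left hx0 (hti i) ((hmono hi.2.2).trans hA)) 1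
  · exact sub_nonneg.2 ((div_le_one (hpos.trans_le hht)).2 (hx1.trans hht))
  · exact sub_le_self _ (div_nonneg hx0 (hpos.trans_le hht).le)
end

section
/- For every even natural number n ≥ 2, the central binomial coefficient satisfies C(n, n/2) ≤ (e/(π·√n))·2ⁿ, where e is the base of the natural logarithm. -/
theorem factorial_le_stirling (n : ℕ) (hn : n ≠ 0) :
    (n.factorial : ℝ) ≤ Real.exp 1 * Real.sqrt n * (n / Real.exp 1) ^ n := by
  obtain ⟨k, rfl⟩ := Nat.exists_eq_succ_of_ne_zero hn
  have h : Stirling.stirlingSeq (k + 1) ≤ Stirling.stirlingSeq 1 :=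
    Stirling.stirlingSeq'_antitone (Nat.zero_le k)
  rw [Stirling.stirlingSeq_one, Stirling.stirlingSeq, div_le_iff₀ (by positivity),
    Real.sqrt_mul (by norm_num)] at h
  refine h.trans (le_of_eq ?_)
  field_simp

theorem central_binom_upper_bound (n : ℕ) (hn : 2 ≤ n) (hne : Even n) :
    (n.choose (n / 2) : ℝ) ≤ (Real.exp 1 / (Real.pi * Real.sqrt n)) * 2 ^ n := by
  obtain ⟨m, rfl⟩ := even_iff_exists_two_mul.mp hne
  have hm : 0 < m := by omega
  have hm' : (0 : ℝ) < m := by exact_mod_cast hm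
  have hupper := factorial_le_stirling (2 * m) (by omega)
  have hlower : 2 * Real.pi * m * (m / Real.exp 1) ^ (2 * m) ≤ (m.factorial : ℝ) ^ 2 := by
    calc 2 * Real.pi * m * (m / Real.exp 1) ^ (2 * m)
        = (Real.sqrt (2 * Real.pi * m) * (m / Real.exp 1) ^ m) ^ 2 := by
          rw [mul_pow, Real.sq_sqrt (by positivity), ← pow_mul, mul_comm m 2]
      _ ≤ _ := by gcongr; exact Stirling.le_factorial_stirling m
  have hchoose : ((2 * m).choose m : ℝ) = (2 * m).factorial / (m.factorial : ℝ) ^ 2 := by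
    rw [Nat.cast_choose ℝ (by omega), show 2 * m - m = m by omega, sq]
  rw [Nat.mul_div_cancel_left m two_pos, hchoose, div_le_iff₀ (by positivity)]
  refine hupper.trans (le_trans (le_of_eq ?_) (mul_le_mul_of_nonneg_left hlower (by positivity)))
  have hsq : Real.sqrt ((2 * m : ℕ) : ℝ) ^ 2 = 2 * m := by
    rw [Real.sq_sqrt (by positivity)]; push_cast; ring
  have hpos : 0 < Real.sqrt ((2 * m : ℕ) : ℝ) := Real.sqrt_pos.mpr (by positivity)
  have hpow : (((2 * m : ℕ) : ℝ) / Real.exp 1) ^ (2 * m) =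
      2 ^ (2 * m) * (m / Real.exp 1) ^ (2 * m) := by
    rw [← mul_pow]; push_cast; ring
  rw [hpow]
  generalize ((m : ℝ) / Real.exp 1) ^ (2 * m) = x
  generalize (2 : ℝ) ^ (2 * m) = y
  rw [div_mul_eq_mul_div, div_mul_eq_mul_div, eq_div_iff (by positivity)]
  linear_combination Real.exp 1 * y * x * Real.pi * hsq
end

section
/- Let n ≥ 2 be an even natural number and let p be a real number with 11/12 ≤ p ≤ 1. Then Σ_{k=0}^{n/2 − 1} C(n, k)·pᵏ·(1 − p)^{n − k} ≤ (e/(2π))·(1/n), where e is the base of the natural logarithm. Equivalently, Σ_{k=n/2}^{n} C(n, k)·pᵏ·(1 − p)^{n − k} ≥ 1 − (e/(2π))·(1/n). -/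
open Finset

/-- For `p ∈ [11/12, 1]`, the lower half of the binomial distribution with `2 * m` trials has
exponentially small mass. -/
lemma sum_range_choose_mul_pow_le (m : ℕ) (p : ℝ) (hp0 : 11 / 12 ≤ p) (hp1 : p ≤ 1) :
    ∑ k ∈ Finset.range m, ((2 * m).choose k : ℝ) * p ^ k * (1 - p) ^ (2 * m - k)
      ≤ 1 / (12 * 3 ^ m) := by
  have hterm : ∀ k ∈ Finset.range m, ((2 * m).choose k : ℝ) * p ^ k * (1 - p) ^ (2 * m - k)
      ≤ ((2 * m).choose k : ℝ) * (1 / 12) ^ (m + 1) := by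
    intro k hk
    have hkm := Finset.mem_range.mp hk
    have hp : p ^ k ≤ 1 := pow_le_one₀ (by linarith) hp1
    have hq : (1 - p) ^ (2 * m - k) ≤ (1 / 12 : ℝ) ^ (m + 1) :=
      (pow_le_pow_of_le_one (by linarith) (by linarith) (by omega)).trans
        (pow_le_pow_left₀ (by linarith) (by linarith) _)
    have hq0 : 0 ≤ (1 - p) ^ (2 * m - k) := pow_nonneg (by linarith) _
    rw [mul_assoc]
    exact mul_le_mul_of_nonneg_left ((mul_le_of_le_one_left hq0 hp).trans hq) (Nat.cast_nonneg _)
  have hchoose : ∑ k ∈ Finset.range m, ((2 * m).choose k : ℝ) ≤ 4 ^ m := by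
    have h : ∑ k ∈ Finset.range m, (2 * m).choose k ≤ 4 ^ m := by
      calc ∑ k ∈ Finset.range m, (2 * m).choose k
          ≤ ∑ k ∈ Finset.range (2 * m + 1), (2 * m).choose k :=
            Finset.sum_le_sum_of_subset (Finset.range_subset_range.mpr (by omega))
        _ = 4 ^ m := by rw [Nat.sum_range_choose, pow_mul]; norm_num
    exact_mod_cast h
  calc _ ≤ ∑ k ∈ Finset.range m, ((2 * m).choose k : ℝ) * (1 / 12) ^ (m + 1) :=
        Finset.sum_le_sum hterm
    _ = (∑ k ∈ Finset.range m, ((2 * m).choose k : ℝ)) * (1 / 12) ^ (m + 1) :=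
        (Finset.sum_mul ..).symm
    _ ≤ 4 ^ m * (1 / 12) ^ (m + 1) := by gcongr
    _ = 1 / (12 * 3 ^ m) := by
        rw [pow_succ, ← mul_assoc, ← mul_pow, show (4 : ℝ) * (1 / 12) = 1 / 3 by norm_num,
          one_div_pow, one_div_mul_one_div, mul_comm]

theorem binomial_tail_bound_eleven_twelfths
    (n : ℕ) (hn : 2 ≤ n) (hne : Even n) (p : ℝ) (hp0 : 11 / 12 ≤ p) (hp1 : p ≤ 1) :
    (∑ k ∈ Finset.range (n / 2), (n.choose k : ℝ) * p ^ k * (1 - p) ^ (n - k)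
        ≤ (Real.exp 1 / (2 * Real.pi)) * (1 / n)) ∧
    (1 - (Real.exp 1 / (2 * Real.pi)) * (1 / n)
        ≤ ∑ k ∈ Finset.Icc (n / 2) n, (n.choose k : ℝ) * p ^ k * (1 - p) ^ (n - k)) := by
  have hlower : ∑ k ∈ Finset.range (n / 2), (n.choose k : ℝ) * p ^ k * (1 - p) ^ (n - k)
      ≤ (Real.exp 1 / (2 * Real.pi)) * (1 / n) := by
    obtain ⟨m, rfl⟩ := hne.two_dvd
    rw [Nat.mul_div_cancel_left m two_pos]
    refine (sum_range_choose_mul_pow_le m p hp0 hp1).trans ?_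
    have hm : (0 : ℝ) < m := by exact_mod_cast (by omega : 0 < m)
    have h3 : (m : ℝ) ≤ 3 ^ m := by exact_mod_cast (Nat.lt_pow_self (by norm_num)).le
    have he : 2 ≤ Real.exp 1 := by linarith [Real.add_one_le_exp (1 : ℝ)]
    have hpi := Real.pi_pos
    have hc : 1 / 6 ≤ Real.exp 1 / (2 * Real.pi) := by
      rw [div_le_div_iff₀ (by norm_num) (by positivity)]
      linarith [Real.pi_le_four]
    calc (1 : ℝ) / (12 * 3 ^ m) ≤ 1 / (12 * m) := by gcongr
      _ = 1 / 6 * (1 / (2 * m : ℕ)) := by push_cast; field_simp; norm_num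
      _ ≤ _ := by gcongr
  have htotal : ∑ k ∈ Finset.range (n / 2), (n.choose k : ℝ) * p ^ k * (1 - p) ^ (n - k)
      + ∑ k ∈ Finset.Icc (n / 2) n, (n.choose k : ℝ) * p ^ k * (1 - p) ^ (n - k) = 1 := by
    rw [← Finset.Ico_add_one_right_eq_Icc, Finset.sum_range_add_sum_Ico _ (by omega)]
    have h := add_pow p (1 - p) n
    rw [add_sub_cancel, one_pow] at h
    exact (Finset.sum_congr rfl fun k _ => by ring).trans h.symm
  exact ⟨hlower, by linarith⟩
end

section
/- Let n ≥ 2 be an even natural number, let μ be a Borel probability measure on ℝ, and let c ∈ ℝ be such that μ((−∞, c]) ≥ 11/12. Then the product measure μⁿ of the set { t : Fin n → ℝ | at least n/2 of the indices i satisfy tᵢ ≤ c } is at least 1 − (e/(2π))·(1/n), where e is the base of the natural logarithm. -/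
open MeasureTheory Finset
open scoped ENNReal

/-- Tonelli's theorem for a product of functions of the single coordinates. -/
theorem lintegral_pi_prod_eq {ι α : Type*} [Fintype ι] [MeasurableSpace α] (μ : Measure α)
    [IsProbabilityMeasure μ] {f : α → ℝ≥0∞} (hf : Measurable f) :
    ∫⁻ t, ∏ i, f (t i) ∂Measure.pi (fun _ : ι => μ) = (∫⁻ x, f x ∂μ) ^ Fintype.card ι := by
  have h : ProbabilityTheory.iIndepFun (fun (i : ι) (t : ι → α) => f (t i))
      (Measure.pi fun _ : ι => μ) :=
    ProbabilityTheory.iIndepFun_pi (X := fun _ => f) fun _ => hf.aemeasurable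
  rw [ProbabilityTheory.lintegral_prod_eq_prod_lintegral_of_indepFun _ _ h
    fun i => hf.comp (measurable_pi_apply i)]
  have hi (i : ι) : ∫⁻ t, f (t i) ∂Measure.pi (fun _ : ι => μ) = ∫⁻ x, f x ∂μ :=
    (measurePreserving_eval (fun _ : ι => μ) i).lintegral_comp hf
  simp [hi]

/-- Exponential Markov inequality for the number of coordinates lying in a set `s`. -/
theorem pow_mul_measure_card_ge_le {ι α : Type*} [Fintype ι] [MeasurableSpace α] (μ : Measure α)
    [IsProbabilityMeasure μ] {s : Set α} [DecidablePred (· ∈ s)] (hs : MeasurableSet s)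
    {x : ℝ≥0∞} (hx : 1 ≤ x) (k : ℕ) :
    x ^ k * Measure.pi (fun _ : ι => μ) {t | k ≤ #{i | t i ∈ s}}
      ≤ (x * μ s + μ sᶜ) ^ Fintype.card ι := by
  set f : α → ℝ≥0∞ := s.piecewise (fun _ => x) (fun _ => 1)
  have hf : Measurable f := measurable_const.piecewise hs measurable_const
  have hprod (t : ι → α) : ∏ i, f (t i) = x ^ #{i | t i ∈ s} := by
    simp [f, Set.piecewise, Finset.prod_ite]
  calc x ^ k * Measure.pi (fun _ : ι => μ) {t | k ≤ #{i | t i ∈ s}}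
      ≤ x ^ k * Measure.pi (fun _ : ι => μ) {t | x ^ k ≤ ∏ i, f (t i)} := by
        gcongr with t
        intro ht
        rw [hprod]
        exact pow_le_pow_right₀ hx ht
    _ ≤ ∫⁻ t, ∏ i, f (t i) ∂Measure.pi (fun _ : ι => μ) :=
        mul_meas_ge_le_lintegral
          (Finset.measurable_prod _ fun i _ => hf.comp (measurable_pi_apply i)) _
    _ = (x * μ s + μ sᶜ) ^ Fintype.card ι := by
        rw [lintegral_pi_prod_eq μ hf, lintegral_piecewise hs]
        simp

theorem chernoff_bound_le_exp_one_div_two_pi {m : ℕ} (hm : 1 ≤ m) :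
    (11 / 6 : ℝ) ^ (2 * m) / 11 ^ (m + 1) ≤ Real.exp 1 / (2 * Real.pi) * (1 / (2 * m : ℝ)) := by
  have hm0 : (0 : ℝ) < m := by exact_mod_cast hm
  have he : (1 / 4 : ℝ) ≤ Real.exp 1 / (2 * Real.pi) := by
    rw [div_le_div_iff₀ (by norm_num) (by positivity)]
    linarith [Real.add_one_le_exp 1, Real.pi_le_four]
  have h2 : (m : ℝ) ≤ 2 ^ m := by exact_mod_cast Nat.lt_two_pow_self.le
  calc (11 / 6 : ℝ) ^ (2 * m) / 11 ^ (m + 1) = (11 / 36) ^ m / 11 := by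
        rw [pow_mul, pow_succ 11 m, ← div_div, ← div_pow]
        norm_num
    _ ≤ (1 / 2) ^ m / 8 := by
        refine div_le_div₀ (by positivity) (pow_le_pow_left₀ ?_ ?_ m) ?_ ?_ <;> norm_num
    _ = 1 / 2 ^ m / 8 := by rw [one_div_pow]
    _ ≤ 1 / m / 8 := by gcongr
    _ = 1 / 4 * (1 / (2 * m)) := by field_simp; norm_num
    _ ≤ _ := by gcongr

theorem prob_event_A_lower_bound
    (n : ℕ) (hn : 2 ≤ n) (hne : Even n) (μ : Measure ℝ) [IsProbabilityMeasure μ]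
    (c : ℝ) (hc : (11 / 12 : ℝ≥0∞) ≤ μ (Set.Iic c)) :
    ENNReal.ofReal (1 - Real.exp 1 / (2 * Real.pi) * (1 / n))
      ≤ Measure.pi (fun _ : Fin n => μ)
          { t : Fin n → ℝ | n / 2 ≤ (Finset.univ.filter (fun i => t i ≤ c)).card } := by
  classical
  obtain ⟨m, rfl⟩ := hne.two_dvd
  have hm : 1 ≤ m := by omega
  set P := Measure.pi (fun _ : Fin (2 * m) => μ)
  set A := {t : Fin (2 * m) → ℝ | 2 * m / 2 ≤ #{i | t i ≤ c}}
  have hA : Aᶜ ⊆ {t | m + 1 ≤ #{i | t i ∈ Set.Ioi c}} := by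
    intro t ht
    have hcard := Finset.card_filter_add_card_filter_not
      (s := (Finset.univ : Finset (Fin (2 * m)))) (fun i => t i ≤ c)
    simp only [A, Set.mem_compl_iff, Set.mem_ofPred_eq, not_le, Set.mem_Ioi, Finset.card_univ,
      Fintype.card_fin] at ht hcard ⊢
    omega
  have hmarkov := pow_mul_measure_card_ge_le (ι := Fin (2 * m)) μ (s := Set.Ioi c)
    measurableSet_Ioi (x := 11) (by norm_num) (m + 1)
  have hreal : (11 : ℝ) ^ (m + 1) * P.real Aᶜ ≤ (11 / 6) ^ (2 * m) := by
    have hc' : (11 / 12 : ℝ) ≤ μ.real (Set.Iic c) := by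
      have := ENNReal.toReal_mono (measure_ne_top μ _) hc
      simpa [Measure.real] using this
    have hsum : μ.real (Set.Ioi c) = 1 - μ.real (Set.Iic c) := by
      rw [← Set.compl_Iic, probReal_compl_eq_one_sub measurableSet_Iic]
    have h := ENNReal.toReal_mono (by finiteness)
      ((mul_le_mul_right (measure_mono (μ := P) hA) _).trans hmarkov)
    rw [ENNReal.toReal_mul, ENNReal.toReal_pow, ENNReal.toReal_pow,
      ENNReal.toReal_add (by finiteness) (by finiteness), ENNReal.toReal_mul, Set.compl_Ioi,
      Fintype.card_fin] at h
    change _ * P.real Aᶜ ≤ (_ * μ.real _ + μ.real _) ^ _ at h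
    rw [hsum, ENNReal.toReal_ofNat] at h
    refine h.trans (pow_le_pow_left₀ ?_ (by linarith) _)
    linarith [measureReal_le_one (μ := μ) (s := Set.Iic c)]
  have hbad : P.real Aᶜ ≤ Real.exp 1 / (2 * Real.pi) * (1 / (2 * m : ℝ)) :=
    ((le_div_iff₀' (by positivity)).2 hreal).trans (chernoff_bound_le_exp_one_div_two_pi hm)
  have hunion : 1 ≤ P.real A + P.real Aᶜ := by
    have h := measureReal_union_le (μ := P) A Aᶜ
    rwa [Set.union_compl_self, probReal_univ] at h
  refine ENNReal.ofReal_le_of_le_toReal ?_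
  change _ ≤ P.real A
  push_cast
  linarith
end

section
/- Let n ≥ 4 be an even natural number, let t_min > 0 and α > 0 be reals, and let μ be the Pareto distribution on [t_min, ∞), i.e., the Borel probability measure on ℝ with μ((−∞, t]) = 1 − (t_min/t)^α for t ≥ t_min and μ((−∞, t]) = 0 for t < t_min. Assume the worst-case guarantee that SC_M(t) ≤ ((n + 1)/2)·minᵢ tᵢ for every t : Fin n → ℝ with all coordinates ≥ t_min. Then ∫ (SC_M(t) / minᵢ tᵢ) dμⁿ(t) < 2·12^{1/α} + 1.33. -/
open MeasureTheory Finset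
open scoped ENNReal

/-- The expected social cost of the mechanism on a general input `t`: apply `SCM`
to the nondecreasing rearrangement of `t`. -/
noncomputable def SCMgen {n : ℕ} (t : Fin n → ℝ) (hn : 0 < n) : ℝ :=
  SCM (t ∘ Tuple.sort t) hn

theorem prod_one_sub_div_le {ι : Type*} (A : Finset ι) (s : ι → ℝ) {x c : ℝ} (m : ℕ)
    (hx : 0 ≤ x) (hs : ∀ i, 0 < s i) (hxs : ∀ i, x ≤ s i) (hxc : x ≤ c)
    (hA : m ≤ (A.filter (fun i => s i ≤ c)).card) :
    ∏ i ∈ A, (1 - x / s i) ≤ (1 - x / c) ^ m := by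
  have h0 : ∀ i, 0 ≤ 1 - x / s i := fun i => by
    rw [sub_nonneg, div_le_one (hs i)]; exact hxs i
  have h1 : ∀ i, 1 - x / s i ≤ 1 := fun i => by
    have := div_nonneg hx (hs i).le
    linarith
  have hc0 : 0 ≤ c := hx.trans hxc
  calc ∏ i ∈ A, (1 - x / s i)
      ≤ ∏ i ∈ A.filter (fun i => s i ≤ c), (1 - x / s i) :=
        Finset.prod_le_prod_of_subset_of_le_one (Finset.filter_subset _ _)
          (fun i _ => h0 i) (fun i _ _ => h1 i)
    _ ≤ ∏ i ∈ A.filter (fun i => s i ≤ c), (1 - x / c) := by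
        refine Finset.prod_le_prod (fun i _ => h0 i) fun i hi => ?_
        have := div_le_div_of_nonneg_left hx (hs i) (Finset.mem_filter.1 hi).2
        linarith
    _ = (1 - x / c) ^ (A.filter (fun i => s i ≤ c)).card := by rw [Finset.prod_const]
    _ ≤ (1 - x / c) ^ m := by
        refine pow_le_pow_of_le_one ?_ ?_ hA
        · rw [sub_nonneg]; exact div_le_one_of_le₀ hxc hc0
        · have := div_nonneg hx hc0
          linarith

theorem integral_one_sub_div_pow {c : ℝ} (hc : 0 < c) (m : ℕ) (b : ℝ) :
    ∫ x in (0:ℝ)..b, (1 - x / c) ^ m = c / (m + 1) * (1 - (1 - b / c) ^ (m + 1)) := by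
  have hm : (m : ℝ) + 1 ≠ 0 := by positivity
  have h : ∀ x : ℝ, HasDerivAt (fun x : ℝ => -(c / (m + 1)) * (1 - x / c) ^ (m + 1))
      ((1 - x / c) ^ m) x := fun x => by
    have h1 : HasDerivAt (fun x : ℝ => 1 - x / c) (-(1 / c)) x :=
      ((hasDerivAt_id x).div_const c).const_sub 1
    refine ((h1.pow (m + 1)).const_mul (-(c / (m + 1)))).congr_deriv ?_
    push_cast
    field_simp
  rw [intervalIntegral.integral_eq_sub_of_hasDerivAt (fun x _ => h x)
    (Continuous.intervalIntegrable (by fun_prop) _ _)]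
  simp
  ring

theorem SCM_le_of_card_le {n : ℕ} (s : Fin n → ℝ) (hn : 0 < n) {c : ℝ} {m : ℕ} (hm : 0 < m)
    (hs0 : 0 < s ⟨0, hn⟩) (hmin : ∀ i, s ⟨0, hn⟩ ≤ s i)
    (hcard : m + 1 ≤ (Finset.univ.filter (fun i => s i ≤ c)).card) :
    SCM s hn ≤ n * (c / (m + 1)) := by
  have hs : ∀ i, 0 < s i := fun i => hs0.trans_le (hmin i)
  have hsc : s ⟨0, hn⟩ ≤ c := by
    obtain ⟨i, hi⟩ := Finset.card_pos.1 (by omega : 0 < (Finset.univ.filter (fun i => s i ≤ c)).card)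
    exact (hmin i).trans (Finset.mem_filter.1 hi).2
  have hc : 0 < c := hs0.trans_le hsc
  set z : Fin n := ⟨0, hn⟩ with hz
  have hm' : (0 : ℝ) < m := by exact_mod_cast hm
  have hr0 : 0 ≤ 1 - s z / c := by
    rw [sub_nonneg]; exact div_le_one_of_le₀ hsc hc.le
  have hr1 : 1 - s z / c ≤ 1 := by
    have := div_nonneg hs0.le hc.le
    linarith
  have hcard1 : m ≤ ((Finset.univ.filter (fun i => i ≠ z)).filter (fun i => s i ≤ c)).card := by
    have : Finset.univ.filter (fun i => s i ≤ c) ⊆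
        insert z ((Finset.univ.filter (fun i => i ≠ z)).filter (fun i => s i ≤ c)) := by
      intro i hi
      simp only [Finset.mem_filter, Finset.mem_univ, true_and, Finset.mem_insert] at hi ⊢
      tauto
    have := (Finset.card_le_card this).trans (Finset.card_insert_le _ _)
    omega
  have hcard2 : ∀ k, m - 1 ≤
      ((Finset.univ.filter (fun i => i ≠ z ∧ i ≠ k)).filter (fun i => s i ≤ c)).card := fun k => by
    have : (Finset.univ.filter (fun i => i ≠ z)).filter (fun i => s i ≤ c) ⊆
        insert k ((Finset.univ.filter (fun i => i ≠ z ∧ i ≠ k)).filter (fun i => s i ≤ c)) := by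
      intro i hi
      simp only [Finset.mem_filter, Finset.mem_univ, true_and, Finset.mem_insert] at hi ⊢
      tauto
    have := (Finset.card_le_card this).trans (Finset.card_insert_le _ _)
    omega
  have hfirst : (∫ y in (0:ℝ)..(s z), ∏ i ∈ Finset.univ.filter (fun i => i ≠ z), (1 - y / s i))
      ≤ c / (m + 1) := by
    calc _ ≤ ∫ y in (0:ℝ)..(s z), (1 - y / c) ^ m := by
          refine intervalIntegral.integral_mono_on hs0.le
            (Continuous.intervalIntegrable (by fun_prop) _ _)
            (Continuous.intervalIntegrable (by fun_prop) _ _) fun y hy => ?_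
          exact prod_one_sub_div_le _ s m hy.1 hs (fun i => hy.2.trans (hmin i))
            (hy.2.trans hsc) hcard1
      _ = c / (m + 1) * (1 - (1 - s z / c) ^ (m + 1)) := integral_one_sub_div_pow hc m _
      _ ≤ c / (m + 1) * 1 := by
          gcongr
          have := pow_nonneg hr0 (m + 1)
          linarith
      _ = c / (m + 1) := mul_one _
  have hsecond : ∀ k, (1 / s z) * (∫ y in (0:ℝ)..(s z), ∫ x in (0:ℝ)..y,
      ∏ i ∈ Finset.univ.filter (fun i => i ≠ z ∧ i ≠ k), (1 - x / s i)) ≤ c / (m + 1) := fun k => by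
    have hle : (∫ y in (0:ℝ)..(s z), ∫ x in (0:ℝ)..y,
        ∏ i ∈ Finset.univ.filter (fun i => i ≠ z ∧ i ≠ k), (1 - x / s i))
        ≤ ∫ y in (0:ℝ)..(s z), c / m * (1 - (1 - y / c) ^ m) := by
      refine intervalIntegral.integral_mono_on hs0.le
        (Continuous.intervalIntegrable (intervalIntegral.continuous_primitive
          (fun a b => Continuous.intervalIntegrable (by fun_prop) _ _) 0) _ _)
        (Continuous.intervalIntegrable (by fun_prop) _ _) fun y hy => ?_
      calc _ ≤ ∫ x in (0:ℝ)..y, (1 - x / c) ^ (m - 1) := by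
            refine intervalIntegral.integral_mono_on hy.1
              (Continuous.intervalIntegrable (by fun_prop) _ _)
              (Continuous.intervalIntegrable (by fun_prop) _ _) fun x hx => ?_
            have hxz := hx.2.trans hy.2
            exact prod_one_sub_div_le _ s (m - 1) hx.1 hs (fun i => hxz.trans (hmin i))
              (hxz.trans hsc) (hcard2 k)
        _ = c / m * (1 - (1 - y / c) ^ m) := by
            rw [integral_one_sub_div_pow hc, Nat.sub_add_cancel hm, Nat.cast_pred hm,
              sub_add_cancel]
    have hval : (∫ y in (0:ℝ)..(s z), c / m * (1 - (1 - y / c) ^ m))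
        = c / m * (s z - c / (m + 1) * (1 - (1 - s z / c) ^ (m + 1))) := by
      rw [intervalIntegral.integral_const_mul, intervalIntegral.integral_sub
        (Continuous.intervalIntegrable (by fun_prop) _ _)
        (Continuous.intervalIntegrable (by fun_prop) _ _), integral_one_sub_div_pow hc]
      simp
    have hpow : (1 - s z / c) ^ (m + 1) ≤ 1 - s z / c :=
      pow_le_of_le_one hr0 hr1 (Nat.succ_ne_zero m)
    have hbd : c / m * (s z - c / (m + 1) * (1 - (1 - s z / c) ^ (m + 1)))
        ≤ s z * (c / (m + 1)) := by
      calc _ ≤ c / m * (s z - c / (m + 1) * (1 - (1 - s z / c))) := by gcongr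
        _ = s z * (c / (m + 1)) := by field_simp; ring
    rw [one_div, inv_mul_le_iff₀ hs0]
    exact hle.trans (hval.le.trans hbd)
  have hcardz : (Finset.univ.filter (fun k : Fin n => k ≠ z)).card = n - 1 := by
    rw [Finset.filter_ne' Finset.univ z, Finset.card_erase_of_mem (Finset.mem_univ _),
      Finset.card_univ, Fintype.card_fin]
  have hsum := Finset.sum_le_card_nsmul (Finset.univ.filter (fun k : Fin n => k ≠ z)) _ _
    (fun k _ => hsecond k)
  rw [hcardz, nsmul_eq_mul, Nat.cast_pred hn] at hsum
  unfold SCM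
  linarith

theorem comp_sort_zero_eq_inf' {n : ℕ} (t : Fin n → ℝ) (hn : 0 < n)
    (h : (Finset.univ : Finset (Fin n)).Nonempty) :
    (t ∘ Tuple.sort t) ⟨0, hn⟩ = Finset.univ.inf' h t := by
  refine le_antisymm (Finset.le_inf' _ _ fun i _ => ?_) (Finset.inf'_le _ (Finset.mem_univ _))
  have := Tuple.monotone_sort t (a := ⟨0, hn⟩) (b := (Tuple.sort t).symm i) (Nat.zero_le _)
  simpa using this

theorem SCMgen_div_inf'_le {n m : ℕ} (t : Fin n → ℝ) (hn : 0 < n)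
    (h : (Finset.univ : Finset (Fin n)).Nonempty) {a L : ℝ} (ha : 0 < a) (hL : 0 ≤ L)
    (hm : 0 < m) (hnm : n ≤ 2 * m) (ht : ∀ i, a ≤ t i)
    (hcard : m + 1 ≤ (Finset.univ.filter (fun i => t i ≤ a * L)).card) :
    SCMgen t hn / Finset.univ.inf' h t ≤ 2 * L := by
  have hinf : a ≤ Finset.univ.inf' h t := Finset.le_inf' _ _ fun i _ => ht i
  have hle : SCMgen t hn ≤ n * (a * L / (m + 1)) := by
    refine SCM_le_of_card_le _ hn hm ?_ ?_ ?_
    · exact ha.trans_le (ht _)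
    · exact fun i => Tuple.monotone_sort t (Nat.zero_le _ : (⟨0, hn⟩ : Fin n) ≤ i)
    · refine hcard.trans_eq (Eq.symm ?_)
      refine Finset.card_equiv (Tuple.sort t) fun i => ?_
      simp
  have hnm' : (n : ℝ) ≤ 2 * (m + 1) := by
    have : (n : ℝ) ≤ 2 * m := by exact_mod_cast hnm
    linarith
  rw [div_le_iff₀ (ha.trans_le hinf)]
  calc SCMgen t hn ≤ n * (a * L / (m + 1)) := hle
    _ ≤ 2 * (m + 1) * (a * L / (m + 1)) := by gcongr
    _ = 2 * L * a := by field_simp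
    _ ≤ 2 * L * Finset.univ.inf' h t := by gcongr

theorem measure_pi_iUnion_powersetCard_le {n : ℕ} (μ : Measure ℝ) [IsProbabilityMeasure μ]
    (A : Set ℝ) (m : ℕ) :
    Measure.pi (fun _ : Fin n => μ) (⋃ S ∈ Finset.powersetCard m (Finset.univ : Finset (Fin n)),
      Set.univ.pi (fun i => if i ∈ S then A else Set.univ)) ≤ 2 ^ n * μ A ^ m := by
  refine (measure_biUnion_finset_le _ _).trans ?_
  have hS : ∀ S ∈ Finset.powersetCard m (Finset.univ : Finset (Fin n)),
      Measure.pi (fun _ : Fin n => μ) (Set.univ.pi (fun i => if i ∈ S then A else Set.univ))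
        ≤ μ A ^ m := fun S hS => by
    rw [Measure.pi_pi]
    simp only [apply_ite μ, measure_univ]
    rw [Finset.prod_ite_mem, Finset.univ_inter, Finset.prod_const,
      (Finset.mem_powersetCard.1 hS).2]
  refine (Finset.sum_le_card_nsmul _ _ _ hS).trans ?_
  rw [nsmul_eq_mul]
  gcongr
  rw [Finset.card_powersetCard, Finset.card_univ, Fintype.card_fin]
  exact_mod_cast Nat.choose_le_two_pow n m

theorem average_case_ratio_bound_pareto
    (n : ℕ) (hn4 : 4 ≤ n) (hne : Even n) (tmin α : ℝ) (htmin : 0 < tmin) (hα : 0 < α)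
    (μ : Measure ℝ) [IsProbabilityMeasure μ]
    (hcdf₁ : ∀ x : ℝ, tmin ≤ x → μ (Set.Iic x) = ENNReal.ofReal (1 - (tmin / x) ^ α))
    (hcdf₂ : ∀ x : ℝ, x < tmin → μ (Set.Iic x) = 0)
    (hwc : ∀ t : Fin n → ℝ, (∀ i, tmin ≤ t i) →
      SCMgen t (by omega) ≤
        (((n : ℝ) + 1) / 2) * Finset.univ.inf' ⟨⟨0, by omega⟩, Finset.mem_univ _⟩ t) :
    ∫ t : Fin n → ℝ,
        SCMgen t (by omega) / Finset.univ.inf' ⟨⟨0, by omega⟩, Finset.mem_univ _⟩ t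
        ∂(Measure.pi (fun _ : Fin n => μ))
      < 2 * (12 : ℝ) ^ (1 / α) + 1.33 := by
  obtain ⟨m, hm⟩ := hne
  have hm2 : 2 ≤ m := by omega
  have hL1 : (1 : ℝ) ≤ (12 : ℝ) ^ (1 / α) := Real.one_le_rpow (by norm_num) (by positivity)
  have hLα : ((12 : ℝ) ^ (1 / α)) ^ α = 12 := by
    rw [← Real.rpow_mul (by norm_num), one_div_mul_cancel hα.ne', Real.rpow_one]
  set L : ℝ := (12 : ℝ) ^ (1 / α) with hLdef
  have hL0 : 0 < L := by linarith
  have hsupp : ∀ᵐ x ∂μ, tmin ≤ x := by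
    have h := hcdf₁ tmin le_rfl
    rw [div_self htmin.ne', Real.one_rpow, sub_self, ENNReal.ofReal_zero] at h
    rw [ae_iff]
    refine measure_mono_null (fun x hx => ?_) h
    exact (not_le.1 hx).le
  have hsuppn : ∀ᵐ t ∂(Measure.pi (fun _ : Fin n => μ)), ∀ i, tmin ≤ t i :=
    ae_all_iff.2 fun i => (Measure.quasiMeasurePreserving_eval (fun _ : Fin n => μ) i).ae hsupp
  have htail : μ (Set.Ioi (tmin * L)) = ENNReal.ofReal (1 / 12) := by
    have h := hcdf₁ (tmin * L) (le_mul_of_one_le_right htmin.le hL1)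
    rw [div_mul_cancel_left₀ htmin.ne', Real.inv_rpow hL0.le, hLα] at h
    rw [← Set.compl_Iic, prob_compl_eq_one_sub measurableSet_Iic, h, ← ENNReal.ofReal_one,
      ← ENNReal.ofReal_sub _ (by norm_num)]
    norm_num
  set P := Measure.pi (fun _ : Fin n => μ) with hP
  set B : Set (Fin n → ℝ) :=
    ⋃ S ∈ Finset.powersetCard m (Finset.univ : Finset (Fin n)),
      Set.univ.pi (fun i => if i ∈ S then Set.Ioi (tmin * L) else Set.univ) with hB
  have hBmeas : MeasurableSet B := by
    refine Finset.measurableSet_biUnion _ fun S _ => MeasurableSet.univ_pi fun i => ?_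
    split_ifs
    exacts [measurableSet_Ioi, MeasurableSet.univ]
  have hPB : P.real B ≤ (1 / 3) ^ m := by
    have h := measure_pi_iUnion_powersetCard_le (n := n) μ (Set.Ioi (tmin * L)) m
    refine ENNReal.toReal_le_of_le_ofReal (by positivity) (h.trans_eq ?_)
    rw [htail, ← ENNReal.ofReal_ofNat, ← ENNReal.ofReal_pow (by norm_num),
      ← ENNReal.ofReal_pow (by norm_num), ← ENNReal.ofReal_mul (by positivity), hm, ← two_mul,
      pow_mul, ← mul_pow]
    norm_num
  have hgood : ∀ t ∉ B, m + 1 ≤ (Finset.univ.filter (fun i => t i ≤ tmin * L)).card := by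
    intro t ht
    by_contra! hlt
    refine ht ?_
    have hsplit := Finset.card_filter_add_card_filter_not (s := (Finset.univ : Finset (Fin n)))
      (fun i => t i ≤ tmin * L)
    rw [Finset.card_univ, Fintype.card_fin] at hsplit
    obtain ⟨S, hS, hSm⟩ := Finset.exists_subset_card_eq
      (show m ≤ (Finset.univ.filter (fun i => ¬ t i ≤ tmin * L)).card by omega)
    refine Set.mem_biUnion (Finset.mem_coe.2 (Finset.mem_powersetCard.2
      ⟨Finset.subset_univ _, hSm⟩)) fun i _ => ?_
    by_cases hi : i ∈ S
    · simpa [hi] using hS hi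
    · simp [hi]
  have hpow : ((n : ℝ) + 1) / 2 * (1 / 3) ^ m ≤ 5 / 18 := by
    have hnm : (n : ℝ) = 2 * m := by rw [hm]; push_cast; ring
    rw [hnm]
    clear * - hm2
    induction m, hm2 using Nat.le_induction with
    | base => norm_num
    | succ k hk ih =>
      refine le_trans ?_ ih
      have hk' : (2 : ℝ) ≤ k := by exact_mod_cast hk
      rw [pow_succ]
      push_cast
      nlinarith [pow_pos (show (0 : ℝ) < 1 / 3 by norm_num) k]
  by_cases hint : Integrable (fun t : Fin n → ℝ => SCMgen t (by omega) /
      Finset.univ.inf' ⟨⟨0, by omega⟩, Finset.mem_univ _⟩ t) P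
  swap
  · rw [integral_undef hint]
    positivity
  have hgi : Integrable (B.indicator fun _ => ((n : ℝ) + 1) / 2) P :=
    (integrable_const _).indicator hBmeas
  calc _ ≤ ∫ t, (2 * L + B.indicator (fun _ => ((n : ℝ) + 1) / 2) t) ∂P := by
        refine integral_mono_ae hint ((integrable_const _).add hgi) ?_
        filter_upwards [hsuppn] with t ht
        by_cases htB : t ∈ B
        · rw [Set.indicator_of_mem htB]
          have hpos : 0 < Finset.univ.inf' ⟨⟨0, by omega⟩, Finset.mem_univ _⟩ t :=
            htmin.trans_le (Finset.le_inf' _ _ fun i _ => ht i)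
          have := (div_le_iff₀ hpos).2 (hwc t ht)
          linarith
        · rw [Set.indicator_of_notMem htB, add_zero]
          exact SCMgen_div_inf'_le t _ _ htmin hL0.le (by omega) (by omega) ht (hgood t htB)
    _ = 2 * L + ((n : ℝ) + 1) / 2 * P.real B := by
        rw [integral_add (integrable_const _) hgi, integral_indicator_const _ hBmeas]
        simp [mul_comm]
    _ ≤ 2 * L + ((n : ℝ) + 1) / 2 * (1 / 3) ^ m := by gcongr
    _ < 2 * L + 1.33 := by
        have : (5 / 18 : ℝ) < 1.33 := by norm_num
        linarith
end

section
/- Let n ≥ 4 be an even natural number, let t_min > 0 and β > 0 be reals with t_min ≤ 11^{1/β}, and let μ be a Borel probability measure on ℝ supported on [t_min, ∞) such that μ((−∞, t]) = t^β/(1 + t^β) for all t ≥ 11^{1/β} (the log-logistic cumulative distribution with scale parameter 1 and shape parameter β). Assume the worst-case guarantee that SC_M(t) ≤ ((n + 1)/2)·minᵢ tᵢ for every t : Fin n → ℝ with all coordinates ≥ t_min. Then ∫ (SC_M(t) / minᵢ tᵢ) dμⁿ(t) < 2·11^{1/β}/t_min + 1.33. -/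
open MeasureTheory Finset
open scoped ENNReal

lemma prod_one_sub_div_le_pow_s13 {ι : Type*} [DecidableEq ι] {A B : Finset ι} (hAB : A ⊆ B)
    {s : ι → ℝ} {y L : ℝ} {m : ℕ} (hy : 0 ≤ y) (hyL : y ≤ L) (hL : 0 < L)
    (hs : ∀ i ∈ B, 0 < s i) (hys : ∀ i ∈ B, y ≤ s i) (hA : ∀ i ∈ A, s i ≤ L) (hm : m ≤ #A) :
    ∏ i ∈ B, (1 - y / s i) ≤ (1 - y / L) ^ m := by
  have h0 : ∀ i ∈ B, 0 ≤ 1 - y / s i := fun i hi => by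
    rw [sub_nonneg, div_le_one (hs i hi)]
    exact hys i hi
  have h1 : ∀ i ∈ B, 1 - y / s i ≤ 1 := fun i hi => by
    have := div_nonneg hy (hs i hi).le
    linarith
  have hL0 : 0 ≤ 1 - y / L := by
    rw [sub_nonneg, div_le_one hL]
    exact hyL
  have hL1 : 1 - y / L ≤ 1 := by
    have := div_nonneg hy hL.le
    linarith
  calc ∏ i ∈ B, (1 - y / s i)
      = (∏ i ∈ B \ A, (1 - y / s i)) * ∏ i ∈ A, (1 - y / s i) :=
        (Finset.prod_sdiff hAB).symm
    _ ≤ 1 * ∏ i ∈ A, (1 - y / s i) := by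
        refine mul_le_mul_of_nonneg_right ?_ (Finset.prod_nonneg fun i hi => h0 i (hAB hi))
        exact Finset.prod_le_one (fun i hi => h0 i (Finset.sdiff_subset hi))
          (fun i hi => h1 i (Finset.sdiff_subset hi))
    _ ≤ ∏ _i ∈ A, (1 - y / L) := by
        rw [one_mul]
        refine Finset.prod_le_prod (fun i hi => h0 i (hAB hi)) fun i hi => ?_
        have := div_le_div_of_nonneg_left hy (hs i (hAB hi)) (hA i hi)
        linarith
    _ = (1 - y / L) ^ #A := by rw [Finset.prod_const]
    _ ≤ (1 - y / L) ^ m := pow_le_pow_of_le_one hL0 hL1 hm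

lemma integral_one_sub_div_pow_le_s13 {b L : ℝ} (m : ℕ) (hb : b ≤ L) (hL : 0 < L) :
    ∫ y in (0:ℝ)..b, (1 - y / L) ^ m ≤ L / (m + 1) := by
  have hm : (0 : ℝ) < m + 1 := by positivity
  have hd : ∀ y ∈ Set.uIcc 0 b,
      HasDerivAt (fun y : ℝ => -(L / (m + 1)) * (1 - y / L) ^ (m + 1)) ((1 - y / L) ^ m) y := by
    intro y _
    have h := ((((hasDerivAt_id y).div_const L).const_sub 1).pow (m + 1)).const_mul
      (-(L / ((m : ℝ) + 1)))
    refine h.congr_deriv ?_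
    simp only [id, Nat.add_sub_cancel]
    push_cast
    field_simp
  rw [intervalIntegral.integral_eq_sub_of_hasDerivAt hd
    (Continuous.intervalIntegrable (by fun_prop) _ _)]
  have h0 : 0 ≤ 1 - b / L := by
    rw [sub_nonneg, div_le_one hL]
    exact hb
  have : 0 ≤ L / (m + 1) * (1 - b / L) ^ (m + 1) := by positivity
  simp only [zero_div, sub_zero, one_pow]
  linarith

lemma integral_prod_one_sub_div_le_s13 {ι : Type*} [DecidableEq ι] {A B : Finset ι} (hAB : A ⊆ B)
    {s : ι → ℝ} {b L : ℝ} {m : ℕ} (hb : 0 ≤ b) (hbL : b ≤ L) (hL : 0 < L)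
    (hs : ∀ i ∈ B, 0 < s i) (hbs : ∀ i ∈ B, b ≤ s i) (hA : ∀ i ∈ A, s i ≤ L) (hm : m ≤ #A) :
    ∫ y in (0:ℝ)..b, ∏ i ∈ B, (1 - y / s i) ≤ L / (m + 1) := by
  refine le_trans (intervalIntegral.integral_mono_on hb
    (Continuous.intervalIntegrable (by fun_prop) _ _)
    (Continuous.intervalIntegrable (by fun_prop) _ _) fun y hy => ?_)
    (integral_one_sub_div_pow_le_s13 m hbL hL)
  exact prod_one_sub_div_le_pow_s13 hAB hy.1 (hy.2.trans hbL) hL hs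
    (fun i hi => hy.2.trans (hbs i hi)) hA hm

/-- If more than half of the processing times are at most `L`, the social cost is at most `2L`. -/
lemma SCM_le_two_mul {k : ℕ} (hk : 0 < k) {s : Fin (k + k) → ℝ} (hn : 0 < k + k) {L : ℝ}
    (hs0 : 0 < s ⟨0, hn⟩) (hmin : ∀ i, s ⟨0, hn⟩ ≤ s i)
    (hcard : k + 1 ≤ #{i | s i ≤ L}) : SCM s hn ≤ 2 * L := by
  have hpos : ∀ i, 0 < s i := fun i => hs0.trans_le (hmin i)
  have hs0L : s ⟨0, hn⟩ ≤ L := by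
    obtain ⟨i, hi⟩ := Finset.card_pos.1 (Nat.lt_of_lt_of_le k.succ_pos hcard)
    exact (hmin i).trans (Finset.mem_filter.1 hi).2
  have hL : 0 < L := hs0.trans_le hs0L
  have hk' : (0 : ℝ) < k := by exact_mod_cast hk
  set z : Fin (k + k) := ⟨0, hn⟩
  set A : Finset (Fin (k + k)) := Finset.univ.filter (fun i => s i ≤ L)
  have hAL : ∀ i ∈ A, s i ≤ L := fun i hi => (Finset.mem_filter.1 hi).2
  have hc1 : k ≤ #(A.erase z) := by
    have := Finset.pred_card_le_card_erase (s := A) (a := z)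
    omega
  have hfirst : ∫ y in (0:ℝ)..(s z), ∏ i ∈ Finset.univ.filter (fun i => i ≠ z), (1 - y / s i)
      ≤ L / (k + 1) :=
    integral_prod_one_sub_div_le_s13 (A := A.erase z)
      (fun i hi => by simpa using (Finset.mem_erase.1 hi).1) hs0.le hs0L hL
      (fun i _ => hpos i) (fun i _ => hmin i) (fun i hi => hAL i (Finset.mem_of_mem_erase hi)) hc1
  have hterm : ∀ j : Fin (k + k), (1 / s z) *
      ∫ y in (0:ℝ)..(s z), ∫ x in (0:ℝ)..y,
        ∏ i ∈ Finset.univ.filter (fun i => i ≠ z ∧ i ≠ j), (1 - x / s i) ≤ L / k := by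
    intro j
    have hc2 : k - 1 ≤ #((A.erase z).erase j) := by
      have := Finset.pred_card_le_card_erase (s := A.erase z) (a := j)
      omega
    have hinner : ∀ y ∈ Set.Icc 0 (s z), ∫ x in (0:ℝ)..y,
        ∏ i ∈ Finset.univ.filter (fun i => i ≠ z ∧ i ≠ j), (1 - x / s i) ≤ L / k := by
      intro y hy
      have h := integral_prod_one_sub_div_le_s13 (A := (A.erase z).erase j)
        (B := Finset.univ.filter (fun i => i ≠ z ∧ i ≠ j)) (s := s) (L := L)
        (fun i hi => by
          simp only [Finset.mem_erase] at hi
          simp [hi.1, hi.2.1]) hy.1 (hy.2.trans hs0L) hL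
        (fun i _ => hpos i) (fun i _ => hy.2.trans (hmin i))
        (fun i hi => hAL i (Finset.mem_of_mem_erase (Finset.mem_of_mem_erase hi))) hc2
      rwa [Nat.cast_pred hk, sub_add_cancel] at h
    have hcont : Continuous fun y : ℝ => ∫ x in (0:ℝ)..y,
        ∏ i ∈ Finset.univ.filter (fun i => i ≠ z ∧ i ≠ j), (1 - x / s i) :=
      intervalIntegral.continuous_primitive
        (fun a b => Continuous.intervalIntegrable (by fun_prop) a b) 0
    have houter := intervalIntegral.integral_mono_on hs0.le (hcont.intervalIntegrable _ _)
      (intervalIntegrable_const (μ := volume)) hinner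
    rw [intervalIntegral.integral_const, smul_eq_mul, sub_zero] at houter
    rwa [one_div, inv_mul_le_iff₀ hs0]
  have hsum := Finset.sum_le_sum fun j (_ : j ∈ Finset.univ.filter (fun j => j ≠ z)) => hterm j
  rw [Finset.sum_const, Finset.filter_ne', Finset.card_erase_of_mem (Finset.mem_univ _),
    Finset.card_univ, Fintype.card_fin, nsmul_eq_mul, Nat.cast_pred hn] at hsum
  have hle : L / (k + 1) ≤ L / k := div_le_div_of_nonneg_left hL.le hk' (by linarith)
  have heq : (((k + k : ℕ) : ℝ) - 1) * (L / k) = 2 * L - L / k := by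
    push_cast
    field_simp
    ring
  rw [← Finset.filter_ne'] at hsum
  unfold SCM
  linarith

lemma SCMgen_le_two_mul {k : ℕ} (hk : 0 < k) {t : Fin (k + k) → ℝ} (hn : 0 < k + k) {L : ℝ}
    (ht : ∀ i, 0 < t i) (hcard : k + 1 ≤ #{i | t i ≤ L}) : SCMgen t hn ≤ 2 * L := by
  refine SCM_le_two_mul hk hn (ht _)
    (fun i => Tuple.monotone_sort t (Fin.mk_le_of_le_val i.1.zero_le))
    (hcard.trans_eq ?_)
  refine (Finset.card_equiv (Tuple.sort t) fun i => ?_).symm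
  simp

lemma pi_real_setOf_forall_mem {ι : Type*} [Fintype ι] [DecidableEq ι] (μ : Measure ℝ)
    [IsProbabilityMeasure μ] (S : Finset ι) (U : Set ℝ) :
    (Measure.pi fun _ : ι => μ).real {t | ∀ i ∈ S, t i ∈ U} = μ.real U ^ #S := by
  have h : {t : ι → ℝ | ∀ i ∈ S, t i ∈ U} =
      Set.univ.pi fun i => if i ∈ S then U else Set.univ := by
    ext t
    simp only [Set.mem_ofPred_eq, Set.mem_pi, Set.mem_univ, forall_const]
    refine forall_congr' fun i => ?_
    split_ifs with hi <;> simp [hi]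
  rw [h, Measure.real, Measure.pi_pi, Measure.real, ← ENNReal.toReal_pow]
  simp [apply_ite]

/-- Union bound for the event that at least `k` of the coordinates lie in `U`. -/
lemma pi_real_setOf_exists_powersetCard_le {ι : Type*} [Fintype ι] [DecidableEq ι]
    (μ : Measure ℝ) [IsProbabilityMeasure μ] (k : ℕ) (U : Set ℝ) :
    (Measure.pi fun _ : ι => μ).real
      (⋃ S ∈ Finset.powersetCard k (Finset.univ : Finset ι), {t | ∀ i ∈ S, t i ∈ U})
      ≤ (Fintype.card ι).choose k * μ.real U ^ k := by
  refine (measureReal_biUnion_finset_le _ _).trans_eq ?_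
  rw [Finset.sum_congr rfl fun S hS => by
    rw [pi_real_setOf_forall_mem, (Finset.mem_powersetCard.1 hS).2]]
  simp

theorem average_case_ratio_bound_loglogistic
    (n : ℕ) (hn4 : 4 ≤ n) (hne : Even n) (tmin β : ℝ) (htmin : 0 < tmin) (hβ : 0 < β)
    (htm : tmin ≤ (11 : ℝ) ^ (1 / β))
    (μ : Measure ℝ) [IsProbabilityMeasure μ]
    (hsupp : μ (Set.Ici tmin) = 1)
    (hcdf : ∀ x : ℝ, (11 : ℝ) ^ (1 / β) ≤ x →
      μ (Set.Iic x) = ENNReal.ofReal (x ^ β / (1 + x ^ β)))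
    (hwc : ∀ t : Fin n → ℝ, (∀ i, tmin ≤ t i) →
      SCMgen t (by omega) ≤
        (((n : ℝ) + 1) / 2) * Finset.univ.inf' ⟨⟨0, by omega⟩, Finset.mem_univ _⟩ t) :
    ∫ t : Fin n → ℝ,
        SCMgen t (by omega) / Finset.univ.inf' ⟨⟨0, by omega⟩, Finset.mem_univ _⟩ t
        ∂(Measure.pi (fun _ : Fin n => μ))
      < 2 * (11 : ℝ) ^ (1 / β) / tmin + 1.33 := by
  obtain ⟨k, rfl⟩ := hne
  have hk : 0 < k := by omega
  set L : ℝ := (11 : ℝ) ^ (1 / β) with hLdef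
  have hL : 0 < L := by positivity
  have hLβ : L ^ β = 11 := by
    rw [hLdef, ← Real.rpow_mul (by norm_num), one_div_mul_cancel hβ.ne', Real.rpow_one]
  have htail : μ.real (Set.Ioi L) = 1 / 12 := by
    rw [← Set.compl_Iic, probReal_compl_eq_one_sub measurableSet_Iic, Measure.real,
      hcdf L le_rfl, hLβ, ENNReal.toReal_ofReal (by norm_num)]
    norm_num
  set P : Measure (Fin (k + k) → ℝ) := Measure.pi fun _ => μ
  set bad : Set (Fin (k + k) → ℝ) :=
    ⋃ S ∈ Finset.powersetCard k (Finset.univ : Finset (Fin (k + k))),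
      {t | ∀ i ∈ S, t i ∈ Set.Ioi L}
  have hbadm : MeasurableSet bad := by
    refine Finset.measurableSet_biUnion _ fun S _ => ?_
    exact MeasurableSet.pi (Finset.countable_toSet S) fun _ _ => measurableSet_Ioi
  have hPbad : P.real bad * (((k + k : ℕ) : ℝ) + 1) / 2 ≤ 1 := by
    have h := pi_real_setOf_exists_powersetCard_le (ι := Fin (k + k)) μ k (Set.Ioi L)
    rw [htail, Fintype.card_fin,
      show (k + k).choose k = Nat.centralBinom k by rw [Nat.centralBinom, two_mul]] at h
    have hc : (Nat.centralBinom k : ℝ) ≤ 4 ^ k := by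
      have : Nat.centralBinom k ≤ 4 ^ k := by
        rw [Nat.centralBinom, show 4 = 2 ^ 2 by norm_num, ← pow_mul]
        exact Nat.choose_le_two_pow _ _
      exact_mod_cast this
    have hp : P.real bad ≤ 1 / 3 ^ k := by
      refine h.trans ((mul_le_mul_of_nonneg_right hc (by positivity)).trans_eq ?_)
      rw [← mul_pow, ← one_div_pow]
      norm_num
    have h3 : (k : ℝ) + 1 ≤ 3 ^ k := by
      have := one_add_mul_le_pow (a := (2 : ℝ)) (by norm_num) k
      norm_num at this
      linarith [(Nat.cast_nonneg k : (0 : ℝ) ≤ k)]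
    rw [le_div_iff₀ (by positivity)] at hp
    push_cast
    nlinarith [measureReal_nonneg (μ := P) (s := bad)]
  have hae : ∀ᵐ t ∂P, ∀ i, tmin ≤ t i := by
    rw [ae_all_iff]
    intro i
    have h1 : ∀ᵐ x ∂μ, x ∈ Set.Ici tmin := (mem_ae_iff_prob_eq_one measurableSet_Ici).2 hsupp
    exact (measurePreserving_eval (fun _ : Fin (k + k) => μ) i).quasiMeasurePreserving.ae h1
  have hR : 0 < 2 * L / tmin := by positivity
  by_cases hint : Integrable (fun t : Fin (k + k) → ℝ =>
      SCMgen t (by omega) / Finset.univ.inf' ⟨⟨0, by omega⟩, Finset.mem_univ _⟩ t) P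
  swap
  · rw [integral_undef hint]
    linarith
  have hgi : Integrable (bad.indicator fun _ => (((k + k : ℕ) : ℝ) + 1) / 2) P :=
    (integrable_const _).indicator hbadm
  have hle : ∫ t, SCMgen t (by omega) / Finset.univ.inf' ⟨⟨0, by omega⟩, Finset.mem_univ _⟩ t ∂P
      ≤ ∫ t, (2 * L / tmin + bad.indicator (fun _ => (((k + k : ℕ) : ℝ) + 1) / 2) t) ∂P := by
    refine integral_mono_ae hint ((integrable_const _).add hgi) ?_
    filter_upwards [hae] with t ht
    have hinf : tmin ≤ Finset.univ.inf' ⟨⟨0, by omega⟩, Finset.mem_univ _⟩ t :=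
      Finset.le_inf' _ _ fun i _ => ht i
    have hinf0 := htmin.trans_le hinf
    by_cases htb : t ∈ bad
    · rw [Set.indicator_of_mem htb]
      have := (div_le_iff₀ hinf0).2 (hwc t ht)
      linarith
    · rw [Set.indicator_of_notMem htb, add_zero]
      have hlt : #{i | ¬ t i ≤ L} < k := by
        by_contra! hge
        obtain ⟨S, hS, hSk⟩ := Finset.exists_subset_card_eq hge
        refine htb (Set.mem_iUnion₂.2 ⟨S, Finset.mem_powersetCard.2 ⟨S.subset_univ, hSk⟩, ?_⟩)
        exact fun i hi => by simpa using hS hi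
      have hadd := Finset.card_filter_add_card_filter_not (s := (Finset.univ : Finset (Fin (k + k))))
        (fun i => t i ≤ L)
      rw [Finset.card_univ, Fintype.card_fin] at hadd
      have hSC := SCMgen_le_two_mul hk (by omega) (fun i => htmin.trans_le (ht i))
        (show k + 1 ≤ #{i | t i ≤ L} by omega)
      exact div_le_div₀ (by positivity) hSC htmin hinf
  rw [integral_add (integrable_const _) hgi, integral_const, integral_indicator_const _ hbadm,
    probReal_univ, one_smul, smul_eq_mul, ← mul_div_assoc] at hle
  linarith
end
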